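/- The hypersimplex Δ_{k,n} is Gorenstein if and only if n = 2k, k = 1, or k = n−1. -/

import Mathlib

open scoped Pointwise

/-- The `λ`-permutohedron `P_λ^m ⊂ ℝ^m`: the convex hull of all coordinate
permutations of the vector `(λ_1, ..., λ_m)`. -/
def permPoly (m : ℕ) (lam : Fin m → ℕ) : Set (Fin m → ℝ) :=
  convexHull ℝ {x : Fin m → ℝ | ∃ σ : Equiv.Perm (Fin m), x = fun i => (lam (σ i) : ℝ)}

/-- A (possibly lower-dimensional) lattice polytope `P` is reflexive with respect to the
lattice point `p` if: `p` lies in the relative (intrinsic) interior of `P`, it is the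
unique lattice point there, and `p` is at lattice distance 1 from every facet of `P`,
i.e. for every facet (an exposed face of dimension `dim P − 1`, exposed by a linear
functional `f`) there is no lattice point of the affine span of `P` whose `f`-value lies
strictly between `f p` and the value of `f` on the facet. -/
def ReflexivePolytope (m : ℕ) (P : Set (Fin m → ℝ)) (p : Fin m → ℤ) : Prop :=
  (fun i => (p i : ℝ)) ∈ intrinsicInterior ℝ P ∧
  (∀ q : Fin m → ℤ, (fun i => (q i : ℝ)) ∈ intrinsicInterior ℝ P → q = p) ∧
  ∀ (f : (Fin m → ℝ) →ₗ[ℝ] ℝ) (F : Set (Fin m → ℝ)), F.Nonempty →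
    F = {x ∈ P | ∀ y ∈ P, f y ≤ f x} →
    Module.finrank ℝ ↥(vectorSpan ℝ F) + 1 = Module.finrank ℝ ↥(vectorSpan ℝ P) →
    ∀ x ∈ F, ∀ z : Fin m → ℤ,
      (fun i => (z i : ℝ)) ∈ affineSpan ℝ P →
      ¬(f (fun i => (p i : ℝ)) < f (fun i => (z i : ℝ)) ∧
        f (fun i => (z i : ℝ)) < f x)

namespace HypG

/-- Slice of the cube `[0,c]^n` by the hyperplane of coordinate sum `s`. -/
def Box (n : ℕ) (c s : ℝ) : Set (Fin n → ℝ) :=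
  {x | (∀ i, 0 ≤ x i ∧ x i ≤ c) ∧ ∑ i, x i = s}

/-- Sum-zero vectors. -/
def W (n : ℕ) : Submodule ℝ (Fin n → ℝ) where
  carrier := {v | ∑ i, v i = 0}
  add_mem' := by
    intro a b ha hb
    simp only [Set.mem_ofPred_eq, Pi.add_apply, Finset.sum_add_distrib] at *
    rw [ha, hb, add_zero]
  zero_mem' := by simp
  smul_mem' := by
    intro r a ha
    simp only [Set.mem_ofPred_eq, Pi.smul_apply, smul_eq_mul, ← Finset.mul_sum] at *
    rw [ha, mul_zero]

lemma mem_W {n : ℕ} {v : Fin n → ℝ} : v ∈ W n ↔ ∑ i, v i = 0 := Iff.rfl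

/-- Sum-zero vectors with `i`-th coordinate zero. -/
def Wi (n : ℕ) (i : Fin n) : Submodule ℝ (Fin n → ℝ) :=
  W n ⊓ LinearMap.ker (LinearMap.proj (R := ℝ) (φ := fun _ : Fin n => ℝ) i)

lemma mem_Wi {n : ℕ} {i : Fin n} {v : Fin n → ℝ} : v ∈ Wi n i ↔ ∑ i, v i = 0 ∧ v i = 0 := by
  simp [Wi, mem_W]

lemma sum_lam (n k : ℕ) (h : k ≤ n) :
    ∑ i : Fin n, (((if i.1 < k then 1 else 0 : ℕ)) : ℝ) = k := by
  have : ∑ i : Fin n, (if i.1 < k then 1 else 0 : ℕ) = k := by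
    rw [Fin.sum_univ_eq_sum_range (fun i => if i < k then 1 else 0) n]
    rw [Finset.sum_ite]
    simp only [Finset.sum_const, smul_eq_mul, mul_one, mul_zero, add_zero]
    have : (Finset.range n).filter (· < k) = Finset.range k := by
      ext; simp; omega
    rw [this]; simp
  exact_mod_cast this

lemma permPoly_eq (n k : ℕ) (hk : 1 ≤ k) (hkn : k < n) :
    permPoly n (fun i => if i.1 < k then 1 else 0) = Box n 1 k := by
  apply Set.Subset.antisymm
  · apply convexHull_min
    · rintro x ⟨σ, rfl⟩
      refine ⟨fun i => ?_, ?_⟩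
      · simp only
        split_ifs <;> simp
      · rw [Equiv.sum_comp σ (fun i : Fin n => (((if i.1 < k then 1 else 0 : ℕ)) : ℝ))]
        exact sum_lam n k hkn.le
    · intro x hx y hy a b ha hb hab
      refine ⟨fun i => ?_, ?_⟩
      · have h1 := hx.1 i
        have h2 := hy.1 i
        simp only [Pi.add_apply, Pi.smul_apply, smul_eq_mul]
        constructor
        · have := mul_nonneg ha h1.1
          have := mul_nonneg hb h2.1
          linarith
        · nlinarith
      · simp only [Pi.add_apply, Pi.smul_apply, smul_eq_mul, Finset.sum_add_distrib,
          ← Finset.mul_sum, hx.2, hy.2]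
        rw [← add_mul, hab, one_mul]
  · intro x hx
    have hk0 : (0 : ℝ) < k := by exact_mod_cast hk
    have hnk : (0 : ℝ) < (n : ℝ) - k := by
      have : (k : ℝ) < n := by exact_mod_cast hkn
      linarith
    let lam : Fin n → ℝ := fun i => (((if i.1 < k then 1 else 0 : ℕ)) : ℝ)
    have hlam : ∑ i, lam i = k := sum_lam n k hkn.le
    let M : Matrix (Fin n) (Fin n) ℝ :=
      fun i j => lam j * (x i / k) + (1 - lam j) * ((1 - x i) / (n - k))
    have hM : M ∈ doublyStochastic ℝ (Fin n) := by
      rw [mem_doublyStochastic_iff_sum]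
      refine ⟨fun i j => ?_, fun i => ?_, fun j => ?_⟩
      · have h1 := div_nonneg (hx.1 i).1 hk0.le
        have h2 := div_nonneg (sub_nonneg.2 (hx.1 i).2) hnk.le
        simp only [M, lam]
        split_ifs <;> simpa
      · simp only [M, Finset.sum_add_distrib, ← Finset.sum_mul, Finset.sum_sub_distrib, hlam]
        simp
        field_simp
        ring
      · simp only [M, Finset.sum_add_distrib, ← Finset.mul_sum, ← Finset.sum_div,
          Finset.sum_sub_distrib, hx.2]
        simp
        field_simp
        ring
    have h1 : (M : Matrix (Fin n) (Fin n) ℝ) ∈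
        convexHull ℝ {σ.permMatrix ℝ | σ : Equiv.Perm (Fin n)} := by
      rw [← doublyStochastic_eq_convexHull_permMatrix]; exact hM
    let L : Matrix (Fin n) (Fin n) ℝ →ₗ[ℝ] (Fin n → ℝ) :=
      { toFun := fun A => A.mulVec lam
        map_add' := fun A B => Matrix.add_mulVec A B lam
        map_smul' := fun r A => Matrix.smul_mulVec r A lam }
    have h2 : L M ∈ L '' convexHull ℝ {σ.permMatrix ℝ | σ : Equiv.Perm (Fin n)} := ⟨M, h1, rfl⟩
    rw [LinearMap.image_convexHull] at h2
    have h3 : L M = x := by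
      funext i
      have hl2 : ∀ j, lam j * lam j = lam j := by
        intro j; simp only [lam]; split_ifs <;> simp
      show ∑ j, M i j * lam j = x i
      have : ∀ j, M i j * lam j = lam j * (x i / k) := by
        intro j
        simp only [M]
        linear_combination (x i / k - (1 - x i) / (n - k)) * hl2 j
      simp only [this, ← Finset.sum_mul, hlam]
      field_simp
    rw [h3] at h2
    refine convexHull_mono ?_ h2
    rintro _ ⟨_, ⟨σ, rfl⟩, rfl⟩
    refine ⟨σ, ?_⟩
    show (σ.permMatrix ℝ).mulVec lam = _
    rw [Matrix.permMatrix_mulVec]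
    rfl

lemma smul_Box (n : ℕ) (c s : ℝ) (hc : 0 < c) : c • Box n 1 s = Box n c (c * s) := by
  ext x
  rw [Set.mem_smul_set_iff_inv_smul_mem₀ hc.ne']
  simp only [Box, Set.mem_ofPred_eq, Pi.smul_apply, smul_eq_mul, ← Finset.mul_sum]
  have h1 : ∀ i, (0 ≤ c⁻¹ * x i ∧ c⁻¹ * x i ≤ 1) ↔ (0 ≤ x i ∧ x i ≤ c) := by
    intro i
    rw [inv_mul_le_iff₀ hc, mul_one, mul_nonneg_iff_of_pos_left (inv_pos.2 hc)]
  simp only [h1, inv_mul_eq_iff_eq_mul₀ hc.ne']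

lemma pert {n : ℕ} (y v : Fin n → ℝ) (c : ℝ) (h : ∀ j, 0 ≤ y j ∧ y j ≤ c)
    (h' : ∀ j, v j = 0 ∨ (0 < y j ∧ y j < c)) :
    ∃ ε > 0, ∀ j, 0 ≤ y j + ε * v j ∧ y j + ε * v j ≤ c := by
  have key : ∀ᶠ ε in nhdsWithin (0 : ℝ) (Set.Ioi 0),
      ∀ j, 0 ≤ y j + ε * v j ∧ y j + ε * v j ≤ c := by
    rw [Filter.eventually_all]
    intro j
    rcases h' j with h0 | h0
    · refine Filter.Eventually.of_forall fun ε => ?_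
      rw [h0, mul_zero, add_zero]; exact h j
    · have hcont : Filter.Tendsto (fun ε : ℝ => y j + ε * v j) (nhds 0) (nhds (y j + 0 * v j)) :=
        Continuous.tendsto (by fun_prop) 0
      rw [zero_mul, add_zero] at hcont
      have := (hcont.eventually (Ioo_mem_nhds h0.1 h0.2)).filter_mono
        (nhdsWithin_le_nhds (s := Set.Ioi 0))
      exact this.mono fun ε hε => ⟨hε.1.le, hε.2.le⟩
  obtain ⟨ε, h1, h2⟩ := (key.and self_mem_nhdsWithin).exists
  exact ⟨ε, h2, h1⟩

lemma vectorSpan_eq {n : ℕ} (F : Set (Fin n → ℝ)) (V : Submodule ℝ (Fin n → ℝ)) (y : Fin n → ℝ)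
    (hy : y ∈ F) (hsub : ∀ a ∈ F, ∀ b ∈ F, a - b ∈ V)
    (h : ∀ v ∈ V, ∃ ε > (0 : ℝ), y + ε • v ∈ F) : vectorSpan ℝ F = V := by
  apply le_antisymm
  · rw [vectorSpan, Submodule.span_le]
    rintro _ ⟨a, ha, b, hb, rfl⟩
    exact hsub a ha b hb
  · intro v hv
    obtain ⟨ε, h0, h1⟩ := h v hv
    have := vsub_mem_vectorSpan ℝ h1 hy
    rw [vsub_eq_sub, add_sub_cancel_left] at this
    exact (Submodule.smul_mem_iff _ h0.ne').1 this

lemma finrank_Wi {n : ℕ} (hn : 2 ≤ n) (i : Fin n) :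
    Module.finrank ℝ (Wi n i) + 1 = Module.finrank ℝ (W n) := by
  let φ : W n →ₗ[ℝ] ℝ := (LinearMap.proj (R := ℝ) (φ := fun _ : Fin n => ℝ) i).comp (W n).subtype
  have hsurj : Function.Surjective φ := by
    have : Nontrivial (Fin n) := Fin.nontrivial_iff_two_le.2 hn
    obtain ⟨j, hj⟩ := exists_ne i
    intro r
    refine ⟨⟨Pi.single i r - Pi.single j r, ?_⟩, ?_⟩
    · rw [mem_W]; simp [Finset.sum_sub_distrib]
    · simp [φ, hj.symm]
  have h1 := φ.finrank_range_add_finrank_ker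
  rw [LinearMap.range_eq_top.2 hsurj, finrank_top, Module.finrank_self] at h1
  have h2 : Wi n i = (LinearMap.ker φ).map (W n).subtype := by
    ext v
    simp only [Wi, Submodule.mem_inf, Submodule.mem_map, φ, LinearMap.mem_ker]
    constructor
    · rintro ⟨a, b⟩
      exact ⟨⟨v, a⟩, b, rfl⟩
    · rintro ⟨a, b, rfl⟩
      exact ⟨a.2, b⟩
  rw [h2, Submodule.finrank_map_subtype_eq, ← h1, add_comm]

lemma vectorSpan_Box {n : ℕ} (hn : 2 ≤ n) {c s : ℝ} (hs : 0 < s) (hsc : s < n * c) :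
    vectorSpan ℝ (Box n c s) = W n := by
  have hn0 : (0 : ℝ) < n := by exact_mod_cast (by omega : 0 < n)
  have h1 : 0 < s / n := by positivity
  have h2 : s / n < c := by rw [div_lt_iff₀ hn0]; linarith
  apply vectorSpan_eq _ _ (fun _ => s / n)
  · refine ⟨fun _ => ⟨h1.le, h2.le⟩, ?_⟩
    simp; field_simp
  · intro a ha b hb
    rw [mem_W]
    simp [ha.2, hb.2]
  · intro v hv
    obtain ⟨ε, h0, h⟩ := pert (fun _ => s / n) v c (fun _ => ⟨h1.le, h2.le⟩) (fun _ => Or.inr ⟨h1, h2⟩)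
    refine ⟨ε, h0, h, ?_⟩
    simp [Finset.sum_add_distrib, ← Finset.mul_sum, mem_W.1 hv]; field_simp

lemma mem_affineSpan_Box {n : ℕ} (hn : 2 ≤ n) {c s : ℝ} (hs : 0 < s) (hsc : s < n * c)
    (z : Fin n → ℝ) : z ∈ affineSpan ℝ (Box n c s) ↔ ∑ i, z i = s := by
  have hn0 : (0 : ℝ) < n := by exact_mod_cast (by omega : 0 < n)
  have h1 : 0 < s / n := by positivity
  have h2 : s / n < c := by rw [div_lt_iff₀ hn0]; linarith
  have hs' : ∑ i : Fin n, s / n = s := by simp; field_simp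
  have hy : (fun _ => s / n) ∈ affineSpan ℝ (Box n c s) :=
    subset_affineSpan ℝ _ ⟨fun _ => ⟨h1.le, h2.le⟩, hs'⟩
  rw [← AffineSubspace.vsub_right_mem_direction_iff_mem hy, direction_affineSpan,
    vectorSpan_Box hn hs hsc, mem_W]
  simp only [vsub_eq_sub, Pi.sub_apply, Finset.sum_sub_distrib, hs', sub_eq_zero]

lemma mem_intInt {n : ℕ} (P : Set (Fin n → ℝ)) (x : Fin n → ℝ) :
    x ∈ intrinsicInterior ℝ P ↔ x ∈ affineSpan ℝ P ∧
      ∃ ε > 0, ∀ y ∈ affineSpan ℝ P, dist y x < ε → y ∈ P := by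
  rw [mem_intrinsicInterior]
  constructor
  · rintro ⟨y, hy, rfl⟩
    refine ⟨y.2, ?_⟩
    rw [mem_interior_iff_mem_nhds, Metric.mem_nhds_iff] at hy
    obtain ⟨ε, h0, h⟩ := hy
    exact ⟨ε, h0, fun z hz hd => h (show (⟨z, hz⟩ : affineSpan ℝ P) ∈ Metric.ball y ε from hd)⟩
  · rintro ⟨hx, ε, h0, h⟩
    refine ⟨⟨x, hx⟩, ?_, rfl⟩
    rw [mem_interior_iff_mem_nhds, Metric.mem_nhds_iff]
    exact ⟨ε, h0, fun z hz => h z z.2 hz⟩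

lemma intInt_Box {n : ℕ} (hn : 2 ≤ n) {c s : ℝ} (hs : 0 < s) (hsc : s < n * c)
    (x : Fin n → ℝ) : x ∈ intrinsicInterior ℝ (Box n c s) ↔
      (∀ i, 0 < x i ∧ x i < c) ∧ ∑ i, x i = s := by
  rw [mem_intInt, mem_affineSpan_Box hn hs hsc]
  simp only [mem_affineSpan_Box hn hs hsc]
  constructor
  · rintro ⟨hx, ε, h0, h⟩
    refine ⟨fun i => ?_, hx⟩
    have : Nontrivial (Fin n) := Fin.nontrivial_iff_two_le.2 hn
    obtain ⟨j, hj⟩ := exists_ne i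
    have key : ∀ t : ℝ, |t| < ε → 0 ≤ x i + t ∧ x i + t ≤ c := by
      intro t ht
      have := (h (x + (Pi.single i t - Pi.single j t)) ?_ ?_).1 i
      · simpa [hj.symm] using this
      · simp [Finset.sum_add_distrib, hx]
      · rw [dist_pi_lt_iff h0]
        intro m
        simp only [Pi.add_apply, Pi.sub_apply, Pi.single_apply, Real.dist_eq, add_sub_cancel_left]
        split_ifs with h1 h2 h2
        · simpa using h0
        · simpa using ht
        · simpa using ht
        · simpa using h0
    have h1 := key (ε / 2) (by rw [abs_of_pos (by linarith)]; linarith)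
    have h2 := key (-(ε / 2)) (by rw [abs_neg, abs_of_pos (by linarith)]; linarith)
    constructor <;> linarith
  · rintro ⟨h, hx⟩
    refine ⟨hx, ?_⟩
    have ho : IsOpen (Set.univ.pi fun _ : Fin n => Set.Ioo (0 : ℝ) c) :=
      isOpen_set_pi Set.finite_univ fun _ _ => isOpen_Ioo
    obtain ⟨ε, h0, hb⟩ := Metric.isOpen_iff.1 ho x (fun i _ => h i)
    refine ⟨ε, h0, fun y hy hd => ⟨fun i => ?_, hy⟩⟩
    have := hb (show y ∈ Metric.ball x ε from hd) i trivial
    exact ⟨this.1.le, this.2.le⟩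

lemma sum_ite_eq_aux {n : ℕ} (i : Fin n) (a t : ℝ) :
    ∑ j : Fin n, (if j = i then a else t) = a + (n - 1) * t := by
  have : ∀ j : Fin n, (if j = i then a else t) = t + (if j = i then a - t else 0) := by
    intro j; split_ifs <;> ring
  simp only [this, Finset.sum_add_distrib]
  simp
  ring

lemma facet_gap {n : ℕ} (hn : 2 ≤ n) {c : ℝ} {S : ℤ} (hs : 0 < (S : ℝ)) (hsc : (S : ℝ) < n * c)
    (p : Fin n → ℤ) (hp : ReflexivePolytope n (Box n c S) p) (i : Fin n) (a r : ℝ)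
    (ha0 : 0 ≤ a) (hac : a ≤ c) (hr : r ≠ 0)
    (hmax : ∀ y ∈ Box n c S, r * y i ≤ r * a)
    (ht0 : 0 < (S : ℝ) - a) (ht1 : (S : ℝ) - a < (n - 1) * c) (m : ℤ) :
    ¬ (r * p i < r * m ∧ r * m < r * a) := by
  have hn1 : (0 : ℝ) < n - 1 := by
    have : (2 : ℝ) ≤ n := by exact_mod_cast hn
    linarith
  obtain ⟨t, rfl⟩ : ∃ t, t = ((S : ℝ) - a) / (n - 1) := ⟨_, rfl⟩
  set t := ((S : ℝ) - a) / (n - 1) with ht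
  have h1 : 0 < t := div_pos ht0 hn1
  have h2 : t < c := by rw [ht, div_lt_iff₀ hn1]; linarith
  have hst : a + (n - 1) * t = S := by rw [ht]; field_simp; ring
  let y : Fin n → ℝ := fun j => if j = i then a else t
  have hyb : ∀ j, 0 ≤ y j ∧ y j ≤ c := by
    intro j; simp only [y]; split_ifs
    · exact ⟨ha0, hac⟩
    · exact ⟨h1.le, h2.le⟩
  have hys : ∑ j, y j = S := by rw [← hst]; exact sum_ite_eq_aux i a t
  have hyi : y i = a := by simp [y]
  let F : Set (Fin n → ℝ) := {x | x ∈ Box n c S ∧ x i = a}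
  have hyF : y ∈ F := ⟨⟨hyb, hys⟩, hyi⟩
  have hspan : vectorSpan ℝ F = Wi n i := by
    apply vectorSpan_eq _ _ y hyF
    · intro u hu v hv
      rw [mem_Wi]
      simp [hu.1.2, hv.1.2, hu.2, hv.2]
    · intro v hv
      rw [mem_Wi] at hv
      obtain ⟨ε, h0, h⟩ := pert y v c hyb (fun j => by
        by_cases hj : j = i
        · left; rw [hj]; exact hv.2
        · right; simp only [y, if_neg hj]; exact ⟨h1, h2⟩)
      refine ⟨ε, h0, ⟨h, ?_⟩, ?_⟩
      · simp [Finset.sum_add_distrib, ← Finset.mul_sum, hv.1, hys]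
      · simp [hv.2, hyi]
  have hnt : Nontrivial (Fin n) := Fin.nontrivial_iff_two_le.2 hn
  obtain ⟨j, hj⟩ := exists_ne i
  have key := hp.2.2 (r • LinearMap.proj (R := ℝ) (φ := fun _ : Fin n => ℝ) i) F ⟨y, hyF⟩ (by
      ext x
      constructor
      · rintro ⟨hx, hxi⟩
        refine ⟨hx, fun u hu => ?_⟩
        have := hmax u hu
        simpa [hxi] using this
      · rintro ⟨hx, hxi⟩
        refine ⟨hx, ?_⟩
        have e1 := hmax x hx
        have e2 := hxi y hyF.1
        simp only [LinearMap.smul_apply, LinearMap.proj_apply, smul_eq_mul, hyi] at e2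
        exact mul_left_cancel₀ hr (le_antisymm e1 e2)) (by
      rw [hspan, vectorSpan_Box hn hs hsc, finrank_Wi hn]) y hyF
      (Pi.single i m + Pi.single j (S - m)) (by
      rw [mem_affineSpan_Box hn hs hsc]
      rw [← Int.cast_sum]
      simp [Finset.sum_add_distrib])
  simpa [hyi, hj.symm] using key

lemma Box_convex (n : ℕ) (c s : ℝ) : Convex ℝ (Box n c s) := by
  intro x hx y hy a b ha hb hab
  refine ⟨fun i => ?_, ?_⟩
  · have h1 := hx.1 i
    have h2 := hy.1 i
    simp only [Pi.add_apply, Pi.smul_apply, smul_eq_mul]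
    constructor
    · have := mul_nonneg ha h1.1
      have := mul_nonneg hb h2.1
      linarith
    · have e1 := mul_le_mul_of_nonneg_left h1.2 ha
      have e2 := mul_le_mul_of_nonneg_left h2.2 hb
      have : a * c + b * c = c := by rw [← add_mul, hab, one_mul]
      linarith
  · simp only [Pi.add_apply, Pi.smul_apply, smul_eq_mul, Finset.sum_add_distrib,
      ← Finset.mul_sum, hx.2, hy.2]
    rw [← add_mul, hab, one_mul]

lemma face_sub {n : ℕ} (hn : 2 ≤ n) {c s : ℝ} (hs : 0 < s) (hsc : s < n * c)
    (f : (Fin n → ℝ) →ₗ[ℝ] ℝ) (F : Set (Fin n → ℝ)) (hne : F.Nonempty)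
    (hF : F = {x ∈ Box n c s | ∀ y ∈ Box n c s, f y ≤ f x})
    (hdim : Module.finrank ℝ (vectorSpan ℝ F) + 1 = Module.finrank ℝ (vectorSpan ℝ (Box n c s))) :
    ∃ i, (∀ x ∈ F, x i = 0) ∨ (∀ x ∈ F, x i = c) := by
  by_contra hcon
  push Not at hcon
  have hFP : ∀ x ∈ F, x ∈ Box n c s := by
    intro x hx; rw [hF] at hx; exact hx.1
  have hFm : ∀ x ∈ F, ∀ y ∈ Box n c s, f y ≤ f x := by
    intro x hx; rw [hF] at hx; exact hx.2
  have hconv : Convex ℝ F := by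
    intro x hx y hy a b ha hb hab
    rw [hF]
    refine ⟨Box_convex n c s (hFP x hx) (hFP y hy) ha hb hab, fun z hz => ?_⟩
    have e1 := mul_le_mul_of_nonneg_left (hFm x hx z hz) ha
    have e2 := mul_le_mul_of_nonneg_left (hFm y hy z hz) hb
    have : a * f z + b * f z = f z := by rw [← add_mul, hab, one_mul]
    simp only [map_add, map_smul, smul_eq_mul]
    linarith
  have hmid : ∀ i, ∃ u ∈ F, 0 < u i ∧ u i < c := by
    intro i
    obtain ⟨⟨x, hx, hx0⟩, ⟨y, hy, hyc⟩⟩ := hcon i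
    have e1 := (hFP x hx).1 i
    have e2 := (hFP y hy).1 i
    have e3 : 0 < x i := lt_of_le_of_ne e1.1 (Ne.symm hx0)
    have e4 : y i < c := lt_of_le_of_ne e2.2 hyc
    refine ⟨(1 / 2 : ℝ) • x + (1 / 2 : ℝ) • y,
      hconv hx hy (by norm_num) (by norm_num) (by norm_num), ?_⟩
    simp only [Pi.add_apply, Pi.smul_apply, smul_eq_mul]
    constructor <;> linarith
  choose u huF hu using hmid
  have hn0 : (0 : ℝ) < n := by exact_mod_cast (by omega : 0 < n)
  have hw : (0 : ℝ) < 1 / n := by positivity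
  have hw1 : ∑ _j : Fin n, (1 / n : ℝ) = 1 := by simp; field_simp
  let y : Fin n → ℝ := ∑ j, (1 / n : ℝ) • u j
  have hyF : y ∈ F := hconv.sum_mem (fun _ _ => hw.le) hw1 (fun j _ => huF j)
  have hyi : ∀ i, y i = ∑ j, (1 / n : ℝ) * u j i := by
    intro i; simp [y, Finset.sum_apply]
  have hy0 : ∀ i, 0 < y i ∧ y i < c := by
    intro i
    rw [hyi]
    constructor
    · exact Finset.sum_pos' (fun j _ => mul_nonneg hw.le ((hFP _ (huF j)).1 i).1)
        ⟨i, Finset.mem_univ i, mul_pos hw (hu i).1⟩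
    · have : c = ∑ _j : Fin n, (1 / n : ℝ) * c := by rw [← Finset.sum_mul, hw1, one_mul]
      conv_rhs => rw [this]
      exact Finset.sum_lt_sum
        (fun j _ => mul_le_mul_of_nonneg_left ((hFP _ (huF j)).1 i).2 hw.le)
        ⟨i, Finset.mem_univ i, mul_lt_mul_of_pos_left (hu i).2 hw⟩
  have hle : ∀ v ∈ W n, f v ≤ 0 := by
    intro v hv
    obtain ⟨ε, h0, h⟩ := pert y v c (hFP y hyF).1 (fun j => Or.inr (hy0 j))
    have := hFm y hyF (y + ε • v) ⟨h, by
      simp [Finset.sum_add_distrib, ← Finset.mul_sum, mem_W.1 hv, (hFP y hyF).2]⟩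
    simp only [map_add, map_smul, smul_eq_mul] at this
    by_contra hcon
    push Not at hcon
    have := mul_pos h0 hcon
    linarith
  have hPF : Box n c s ⊆ F := by
    intro x hx
    rw [hF]
    refine ⟨hx, fun z hz => ?_⟩
    have := hle (z - x) (by rw [mem_W]; simp [hz.2, hx.2])
    rw [map_sub] at this
    linarith
  have : F = Box n c s := Set.Subset.antisymm hFP hPF
  rw [this] at hdim
  omega

lemma refl_of {n : ℕ} (hn : 2 ≤ n) {c s : ℝ} (hs : 0 < s) (hsc : s < n * c) (p : Fin n → ℤ)
    (hp : ∀ i, 0 < (p i : ℝ) ∧ (p i : ℝ) < c) (hps : ∑ i, (p i : ℝ) = s)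
    (huniq : ∀ q : Fin n → ℤ, (∀ i, 0 < (q i : ℝ) ∧ (q i : ℝ) < c) → ∑ i, (q i : ℝ) = s → q = p)
    (H0 : ∀ i, ∃ j, ∃ a : ℤ, (a = p j + 1 ∨ a = p j - 1) ∧ ∀ x ∈ Box n c s, x i = 0 → x j = a)
    (Hc : ∀ i, ∃ j, ∃ a : ℤ, (a = p j + 1 ∨ a = p j - 1) ∧ ∀ x ∈ Box n c s, x i = c → x j = a) :
    ReflexivePolytope n (Box n c s) p := by
  refine ⟨(intInt_Box hn hs hsc _).2 ⟨hp, hps⟩, fun q hq => ?_, ?_⟩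
  · have := (intInt_Box hn hs hsc _).1 hq
    exact huniq q this.1 this.2
  intro f F hne hF hdim x hx z hz
  have hFP : ∀ x ∈ F, x ∈ Box n c s := by
    intro x hx; rw [hF] at hx; exact hx.1
  obtain ⟨j, a, haj, hja⟩ : ∃ j, ∃ a : ℤ, (a = p j + 1 ∨ a = p j - 1) ∧ ∀ x ∈ F, x j = a := by
    obtain ⟨i, hi | hi⟩ := face_sub hn hs hsc f F hne hF hdim
    · obtain ⟨j, a, h1, h2⟩ := H0 i
      exact ⟨j, a, h1, fun x hx => h2 x (hFP x hx) (hi x hx)⟩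
    · obtain ⟨j, a, h1, h2⟩ := Hc i
      exact ⟨j, a, h1, fun x hx => h2 x (hFP x hx) (hi x hx)⟩
  have hspan : vectorSpan ℝ F = Wi n j := by
    apply Submodule.eq_of_le_of_finrank_eq
    · rw [vectorSpan, Submodule.span_le]
      rintro _ ⟨u, hu, v, hv, rfl⟩
      show u - v ∈ Wi n j
      rw [mem_Wi]
      simp [(hFP u hu).2, (hFP v hv).2, hja u hu, hja v hv]
    · rw [vectorSpan_Box hn hs hsc, ← finrank_Wi hn j] at hdim
      omega
  have hf0 : ∀ v ∈ Wi n j, f v = 0 := by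
    intro v hv
    rw [← hspan] at hv
    have hle : vectorSpan ℝ F ≤ LinearMap.ker f := by
      rw [vectorSpan, Submodule.span_le]
      rintro _ ⟨u, hu, v, hv, rfl⟩
      show u - v ∈ LinearMap.ker f
      rw [hF] at hu hv
      rw [LinearMap.mem_ker, map_sub, sub_eq_zero]
      exact le_antisymm (hv.2 u hu.1) (hu.2 v hv.1)
    exact hle hv
  have hnt : Nontrivial (Fin n) := Fin.nontrivial_iff_two_le.2 hn
  obtain ⟨l, hl⟩ := exists_ne j
  let b : ℝ := f (Pi.single j 1 - Pi.single l 1)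
  have hfw : ∀ v ∈ W n, f v = v j * b := by
    intro v hv
    have h1 := hf0 (v - v j • (Pi.single j 1 - Pi.single l 1)) (by
      rw [mem_Wi]
      constructor
      · simp [Finset.sum_sub_distrib, mem_W.1 hv, ← Finset.mul_sum]
      · simp [hl.symm])
    rw [map_sub, map_smul, sub_eq_zero] at h1
    exact h1
  rw [mem_affineSpan_Box hn hs hsc] at hz
  have hxs := (hFP x hx).2
  have e1 := hfw ((fun i => (z i : ℝ)) - fun i => (p i : ℝ)) (by rw [mem_W]; simp [hz, hps])
  have e2 := hfw (x - fun i => (p i : ℝ)) (by rw [mem_W]; simp [hxs, hps])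
  rw [map_sub] at e1 e2
  simp only [Pi.sub_apply] at e1 e2
  rw [hja x hx] at e2
  rintro ⟨g1, g2⟩
  have i1 : 0 < ((z j : ℝ) - p j) * b := by linarith
  have i2 : ((z j : ℝ) - p j) * b < (a - p j) * b := by linarith
  rcases haj with rfl | rfl
  · push_cast at i2
    have hb : 0 < b := by linarith
    have j1 : (0 : ℝ) < (z j : ℝ) - p j := pos_of_mul_pos_left i1 hb.le
    have j2 : (z j : ℝ) - p j < p j + 1 - p j := lt_of_mul_lt_mul_right i2 hb.le
    have k1 : p j < z j := by exact_mod_cast sub_pos.1 j1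
    have k2 : z j < p j + 1 := by
      have : (z j : ℝ) < p j + 1 := by linarith
      exact_mod_cast this
    omega
  · push_cast at i2
    have hb : 0 < -b := by linarith
    have j1 : (0 : ℝ) < (p j : ℝ) - z j := by
      apply pos_of_mul_pos_left (b := -b) _ hb.le
      linarith
    have j2 : (p j : ℝ) - z j < 1 := by
      apply lt_of_mul_lt_mul_right (a := -b) _ hb.le
      linarith
    have k1 : z j < p j := by exact_mod_cast sub_pos.1 j1
    have k2 : p j < z j + 1 := by
      have : (p j : ℝ) < z j + 1 := by linarith
      exact_mod_cast this
    omega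

lemma all_eq_one {n : ℕ} (q : Fin n → ℤ) (h : ∀ i, 1 ≤ q i) (hs : ∑ i, q i = n) :
    ∀ i, q i = 1 := by
  have h1 : ∑ i, (q i - 1) = 0 := by simp [hs]
  have h2 := (Finset.sum_eq_zero_iff_of_nonneg (fun i _ => sub_nonneg.2 (h i))).1 h1
  intro i
  have := h2 i (Finset.mem_univ i)
  omega

lemma others_zero {n : ℕ} (x : Fin n → ℝ) (h : ∀ i, 0 ≤ x i) (i j : Fin n) (hij : j ≠ i)
    (hs : ∑ l, x l = x i) : x j = 0 := by
  have h1 : x i + x j ≤ ∑ l, x l := by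
    rw [← Finset.sum_pair hij.symm]
    exact Finset.sum_le_sum_of_subset_of_nonneg (Finset.subset_univ _) (fun l _ _ => h l)
  have := h j
  linarith

end HypG

/-- The hypersimplex `Δ_{k,n}` (the `(1^k, 0^{n−k})`-permutohedron, i.e. the convex hull
of all 0/1-vectors in `ℝ^n` with exactly `k` ones) is Gorenstein (some positive integer
dilate is reflexive) if and only if `n = 2k`, `k = 1`, or `k = n − 1`. -/
theorem hypersimplex_gorenstein_iff (n k : ℕ) (hk : 1 ≤ k) (hkn : k < n) :
    (∃ c : ℕ, 1 ≤ c ∧ ∃ p : Fin n → ℤ,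
        ReflexivePolytope n ((c : ℝ) • permPoly n (fun i => if i.1 < k then 1 else 0)) p)
      ↔ (n = 2 * k ∨ k = 1 ∨ k = n - 1) := by

  have hn : 2 ≤ n := by omega
  have hk0 : (1 : ℝ) ≤ k := by exact_mod_cast hk
  have hkn' : (k : ℝ) + 1 ≤ n := by exact_mod_cast hkn
  have hP : ∀ c : ℕ, 1 ≤ c → ((c : ℝ) • permPoly n (fun i => if i.1 < k then 1 else 0)) =
      HypG.Box n c (((c * k : ℕ) : ℤ) : ℝ) := by
    intro c hc
    have hc0 : (0 : ℝ) < c := by exact_mod_cast hc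
    rw [HypG.permPoly_eq n k hk hkn, HypG.smul_Box n c k hc0]
    push_cast
    rfl
  have hS : ∀ c : ℕ, 1 ≤ c → (0 : ℝ) < (((c * k : ℕ) : ℤ) : ℝ) ∧
      (((c * k : ℕ) : ℤ) : ℝ) < n * (c : ℝ) := by
    intro c hc
    have hc0 : (0 : ℝ) < c := by exact_mod_cast hc
    push_cast
    constructor
    · positivity
    · nlinarith
  constructor
  · rintro ⟨c, hc, p, hp⟩
    by_contra hcon
    have hk2 : (2 : ℝ) ≤ k := by exact_mod_cast (by omega : 2 ≤ k)
    have hkn2 : (k : ℝ) + 2 ≤ n := by exact_mod_cast (by omega : k + 2 ≤ n)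
    have hc0 : (0 : ℝ) < c := by exact_mod_cast hc
    rw [hP c hc] at hp
    obtain ⟨hs, hsc⟩ := hS c hc
    obtain ⟨hp1, hp2⟩ := (HypG.intInt_Box hn hs hsc _).1 hp.1
    have A : ∀ i, p i = 1 := by
      intro i
      have := HypG.facet_gap hn hs hsc p hp i 0 (-1) le_rfl hc0.le (by norm_num)
        (fun y hy => by have := (hy.1 i).1; linarith) (by linarith)
        (by push_cast; nlinarith) 1
      have h0 : 0 < p i := by exact_mod_cast (hp1 i).1
      by_contra hne
      apply this
      have h2 : (1 : ℝ) < p i := by exact_mod_cast (by omega : 1 < p i)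
      push_cast
      constructor <;> linarith
    have B : ∀ i, p i = c - 1 := by
      intro i
      have := HypG.facet_gap hn hs hsc p hp i c 1 hc0.le le_rfl (by norm_num)
        (fun y hy => by have := (hy.1 i).2; linarith) (by push_cast; nlinarith)
        (by push_cast; nlinarith) (c - 1)
      have h0 : p i < c := by exact_mod_cast (hp1 i).2
      by_contra hne
      apply this
      have h2 : (p i : ℝ) < c - 1 := by exact_mod_cast (by omega : p i < c - 1)
      push_cast
      constructor <;> linarith
    have hc2 : c = 2 := by
      have h1 := A ⟨0, by omega⟩
      have h2 := B ⟨0, by omega⟩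
      omega
    simp only [A] at hp2
    subst hc2
    simp at hp2
    have : n = 2 * k := by exact_mod_cast hp2
    exact hcon (Or.inl this)
  · intro h
    have hnt : Nontrivial (Fin n) := Fin.nontrivial_iff_two_le.2 hn
    have hn2 : (2 : ℝ) ≤ n := by exact_mod_cast hn
    rcases h with h | h | h
    · refine ⟨2, by norm_num, fun _ => 1, ?_⟩
      rw [hP 2 (by norm_num)]
      obtain ⟨hs, hsc⟩ := hS 2 (by norm_num)
      refine HypG.refl_of hn hs hsc _ (fun i => by norm_num) (by simp [h]) ?_ ?_ ?_
      · intro q hq _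
        funext i
        have h1 : 0 < q i := by exact_mod_cast (hq i).1
        have h2 : q i < 2 := by exact_mod_cast (hq i).2
        omega
      · exact fun i => ⟨i, 0, Or.inr (by norm_num), fun x _ hx => by simpa using hx⟩
      · exact fun i => ⟨i, 2, Or.inl (by norm_num), fun x _ hx => by simpa using hx⟩
    · subst h
      refine ⟨n, by omega, fun _ => 1, ?_⟩
      rw [hP n (by omega)]
      obtain ⟨hs, hsc⟩ := hS n (by omega)
      refine HypG.refl_of hn hs hsc _ (fun i => ⟨by norm_num, by push_cast; linarith⟩)
        (by simp) ?_ ?_ ?_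
      · intro q hq hqs
        funext i
        refine HypG.all_eq_one q (fun i => ?_) ?_ i
        · have h1 : 0 < q i := by exact_mod_cast (hq i).1
          omega
        · rw [mul_one] at hqs
          exact_mod_cast hqs
      · exact fun i => ⟨i, 0, Or.inr (by norm_num), fun x _ hx => by simpa using hx⟩
      · intro i
        obtain ⟨j, hj⟩ := exists_ne i
        refine ⟨j, 0, Or.inr (by norm_num), fun x hx hxi => ?_⟩
        rw [HypG.others_zero x (fun l => (hx.1 l).1) i j hj (by rw [hx.2, hxi]; simp)]
        simp
    · have hnk : (n : ℝ) = k + 1 := by exact_mod_cast (by omega : n = k + 1)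
      refine ⟨n, by omega, fun _ => (n : ℤ) - 1, ?_⟩
      rw [hP n (by omega)]
      obtain ⟨hs, hsc⟩ := hS n (by omega)
      refine HypG.refl_of hn hs hsc _ (fun i => ⟨by push_cast; linarith, by push_cast; linarith⟩)
        (by simp [hnk]) ?_ ?_ ?_
      · intro q hq hqs
        funext i
        have := HypG.all_eq_one (fun i => (n : ℤ) - q i) (fun i => ?_) ?_ i
        · omega
        · have h1 : q i < n := by exact_mod_cast (hq i).2
          omega
        · have e : ∑ i, q i = ((n * k : ℕ) : ℤ) := by exact_mod_cast hqs
          have hnk' : (n : ℤ) = k + 1 := by omega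
          simp only [Finset.sum_sub_distrib, e]
          simp [hnk']
          ring
      · intro i
        obtain ⟨j, hj⟩ := exists_ne i
        refine ⟨j, n, Or.inl (by ring), fun x hx hxi => ?_⟩
        have := HypG.others_zero (fun l => (n : ℝ) - x l)
          (fun l => sub_nonneg.2 (hx.1 l).2) i j hj (by
            simp only [Finset.sum_sub_distrib, hx.2, hxi]
            simp [hnk])
        push_cast
        linarith
      · exact fun i => ⟨i, n, Or.inl (by ring), fun x _ hx => by simpa using hx⟩
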